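/- arXiv:2505.12059 — 2 statements merged into one kernel-verified Lean document; each statement's English description precedes it below -/
import Mathlib

section
/- Let H be an infinite-dimensional separable complex Hilbert space, let V be an n-dimensional subspace of L¹(B(H)), and let x ∈ L¹(B(H)) \ V. Then there exist an integer k with 1 ≤ k ≤ 2n+1, scalars λ₁,…,λ_k ∈ [0,1] with λ₁+⋯+λ_k = 1, and operators u₁,…,u_k ∈ B(H), each satisfying uᵢ*uᵢ = Id_H or uᵢuᵢ* = Id_H (each uᵢ is an isometry or a co-isometry), such that Σᵢ λᵢ Tr(uᵢ x) is real and equals dist₁(x,V), and Σᵢ λᵢ Tr(uᵢ v) = 0 for every v ∈ V. -/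
open scoped InnerProductSpace

/-- The absolute value `|a| = sqrt (a* a)` of a bounded operator, via the
continuous functional calculus. -/
noncomputable def opAbs {H : Type*} [NormedAddCommGroup H] [InnerProductSpace ℂ H]
    [CompleteSpace H] (a : H →L[ℂ] H) : H →L[ℂ] H :=
  CFC.sqrt (ContinuousLinearMap.adjoint a * a)

/-- The trace of an operator computed along a fixed Hilbert basis (for trace class
operators this is basis-independent and is the usual trace). -/
noncomputable def traceAlong {H : Type*} [NormedAddCommGroup H] [InnerProductSpace ℂ H]
    [CompleteSpace H] (b : HilbertBasis ℕ ℂ H) (a : H →L[ℂ] H) : ℂ :=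
  ∑' n, ⟪b n, a (b n)⟫_ℂ

/-- `a` is trace class: `∑ ⟨eₙ, |a| eₙ⟩ < ∞` (basis-independent for the positive
operator `|a|`). -/
def IsTraceClass {H : Type*} [NormedAddCommGroup H] [InnerProductSpace ℂ H]
    [CompleteSpace H] (b : HilbertBasis ℕ ℂ H) (a : H →L[ℂ] H) : Prop :=
  Summable fun n => (⟪b n, opAbs a (b n)⟫_ℂ).re

/-- The trace norm `‖a‖₁ = Tr |a|`. -/
noncomputable def traceNorm {H : Type*} [NormedAddCommGroup H] [InnerProductSpace ℂ H]
    [CompleteSpace H] (b : HilbertBasis ℕ ℂ H) (a : H →L[ℂ] H) : ℝ :=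
  ∑' n, (⟪b n, opAbs a (b n)⟫_ℂ).re

/-- If a point lies in a set contained in a hyperplane, the problem of writing it as a convex
combination of extreme points descends to the kernel of the functional. -/
theorem mem_convexHull_extremePoints_of_subset_hyperplane {E : Type*} [NormedAddCommGroup E]
    [NormedSpace ℝ E] {l : E →L[ℝ] ℝ} {c : ℝ} {K : Set E} (hK : IsCompact K) (hc : Convex ℝ K)
    (hl : ∀ y ∈ K, l y = c) {x : E} (hx : x ∈ K)
    (ih : ∀ K' : Set l.ker, IsCompact K' → Convex ℝ K' → K' ⊆ convexHull ℝ (K'.extremePoints ℝ)) :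
    x ∈ convexHull ℝ (K.extremePoints ℝ) := by
  let g : l.ker →ᵃ[ℝ] E := l.ker.subtype.toAffineMap + AffineMap.const ℝ l.ker x
  have hg : ∀ z, g z = (z : E) + x := fun z => rfl
  have hcl : Topology.IsClosedEmbedding g := by
    have h1 : Topology.IsClosedEmbedding (Subtype.val : l.ker → E) :=
      l.isClosed_ker.isClosedEmbedding_subtypeVal
    exact (Homeomorph.addRight x).isClosedEmbedding.comp h1
  have hK' : IsCompact (g ⁻¹' K) := hcl.isCompact_preimage hK
  have hc' : Convex ℝ (g ⁻¹' K) := hc.affine_preimage g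
  have h0 : (0 : l.ker) ∈ g ⁻¹' K := by simpa [hg] using hx
  have h1 := Set.mem_image_of_mem g (ih _ hK' hc' h0)
  rw [AffineMap.image_convexHull] at h1
  have h2 : g 0 = x := by simp [hg]
  rw [h2] at h1
  refine convexHull_mono ?_ h1
  rintro _ ⟨z, hz, rfl⟩
  refine ⟨hz.1, fun y₁ hy₁ y₂ hy₂ hseg => ?_⟩
  have key : ∀ y ∈ K, ∃ w : l.ker, g w = y := fun y hy =>
    ⟨⟨y - x, by simp [hl y hy, hl x hx]⟩, by simp [hg]⟩
  obtain ⟨w₁, rfl⟩ := key y₁ hy₁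
  obtain ⟨w₂, rfl⟩ := key y₂ hy₂
  rw [← image_openSegment] at hseg
  obtain ⟨z', hz', he⟩ := hseg
  obtain rfl := hcl.injective he
  rw [hz.2 hy₁ hy₂ hz']

/-- **Minkowski's theorem**: in finite dimension, a compact convex set is the convex hull of its
extreme points. -/
theorem IsCompact.subset_convexHull_extremePoints {E : Type*} [NormedAddCommGroup E]
    [NormedSpace ℝ E] [FiniteDimensional ℝ E] {K : Set E} (hK : IsCompact K) (hc : Convex ℝ K) :
    K ⊆ convexHull ℝ (K.extremePoints ℝ) := by
  induction hd : Module.finrank ℝ E using Nat.strong_induction_on generalizing E with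
  | _ d IH =>
  have ih : ∀ l : E →L[ℝ] ℝ, l ≠ 0 → ∀ K' : Set l.ker, IsCompact K' → Convex ℝ K' →
      K' ⊆ convexHull ℝ (K'.extremePoints ℝ) := by
    intro l hl K' hK' hc'
    refine IH _ ?_ hK' hc' rfl
    rw [← hd]
    refine Submodule.finrank_lt (fun h => hl ?_)
    ext y
    have : y ∈ l.ker := by rw [h]; trivial
    simpa using this
  intro x hx
  by_cases hne : (interior K).Nonempty
  · by_cases hxi : x ∈ interior K
    · set C := convexHull ℝ (K.extremePoints ℝ) with hC
      have hCK : closure C = K := closure_convexHull_extremePoints hK hc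
      have hCc : Convex ℝ C := convex_convexHull ℝ _
      have hCi : (interior C).Nonempty := by
        rw [hCc.interior_nonempty_iff_affineSpan_eq_top]
        rw [hc.interior_nonempty_iff_affineSpan_eq_top] at hne
        rw [← top_le_iff, ← hne]
        refine affineSpan_le.2 ?_
        rw [← hCK]
        exact closure_minimal (subset_affineSpan ℝ C)
          (AffineSubspace.closed_of_finiteDimensional _)
      have := hCc.interior_closure_eq_interior_of_nonempty_interior hCi
      rw [hCK] at this
      exact interior_subset (this ▸ hxi)
    · obtain ⟨l, hl0, hl⟩ := geometric_hahn_banach_of_nonempty_interior_point hc hxi hne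
      have hexp : IsExposed ℝ K {y ∈ K | ∀ z ∈ K, l z ≤ l y} := fun _ => ⟨l, rfl⟩
      refine convexHull_mono hexp.isExtreme.extremePoints_subset_extremePoints ?_
      refine mem_convexHull_extremePoints_of_subset_hyperplane (l := l) (c := l x)
        (hexp.isCompact hK) (hexp.convex hc) (fun y hy => ?_) ⟨hx, hl⟩ (ih l hl0)
      exact le_antisymm (hl y hy.1) (hy.2 x hx)
  · rw [hc.interior_nonempty_iff_affineSpan_eq_top] at hne
    have hlt : vectorSpan ℝ K < ⊤ := by
      refine lt_top_iff_ne_top.2 fun h => hne ?_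
      rwa [← AffineSubspace.direction_eq_top_iff_of_nonempty
        ((affineSpan_nonempty ℝ).2 ⟨x, hx⟩), direction_affineSpan]
    obtain ⟨f, hf0, hf⟩ := Submodule.exists_le_ker_of_lt_top _ hlt
    let l : E →L[ℝ] ℝ := LinearMap.toContinuousLinearMap f
    refine mem_convexHull_extremePoints_of_subset_hyperplane (l := l) (c := l x)
      hK hc (fun y hy => ?_) hx (ih l fun h => hf0 ?_)
    · have : f (y - x) = 0 := hf (vsub_mem_vectorSpan ℝ hy hx)
      rw [map_sub, sub_eq_zero] at this
      exact this
    · ext y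
      exact congrArg (fun m : E →L[ℝ] ℝ => m y) h

/-- Every point of a compact convex set in a `d`-dimensional space is a convex combination of at
most `d + 1` extreme points. -/
theorem IsCompact.exists_convex_combination_extremePoints {E : Type*} [NormedAddCommGroup E]
    [NormedSpace ℝ E] [FiniteDimensional ℝ E] {K : Set E} (hK : IsCompact K) (hc : Convex ℝ K)
    {x : E} (hx : x ∈ K) :
    ∃ (k : ℕ) (w : Fin k → ℝ) (z : Fin k → E), k ≤ Module.finrank ℝ E + 1 ∧ (∀ i, 0 < w i) ∧
      ∑ i, w i = 1 ∧ (∀ i, z i ∈ K.extremePoints ℝ) ∧ ∑ i, w i • z i = x := by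
  obtain ⟨ι, _, z, w, hz, hind, hw, hw1, hwz⟩ :=
    eq_pos_convex_span_of_mem_convexHull (hK.subset_convexHull_extremePoints hc hx)
  let e := (Fintype.equivFin ι).symm
  refine ⟨Fintype.card ι, w ∘ e, z ∘ e, ?_, fun i => hw _, ?_, fun i => hz ⟨_, rfl⟩, ?_⟩
  · exact hind.card_le_finrank_succ.trans (Nat.succ_le_succ (Submodule.finrank_le _))
  · rw [← hw1]; exact e.sum_comp w
  · rw [← hwz]; exact e.sum_comp fun i => w i • z i
section
variable {H : Type*} [NormedAddCommGroup H] [InnerProductSpace ℂ H] [CompleteSpace H]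

/-- Perturbing a contraction `u` by `(1 - u u*) c (1 - u* u)` with `‖c‖ ≤ 1 / 3` yields a
contraction. -/
theorem norm_add_defect_le_one {u c : H →L[ℂ] H} (hu : ‖u‖ ≤ 1) (hc : ‖c‖ ≤ 1 / 3) :
    ‖u + (1 - u * star u) * c * (1 - star u * u)‖ ≤ 1 := by
  refine ContinuousLinearMap.opNorm_le_bound _ zero_le_one fun ξ => ?_
  have hu' : ‖star u‖ ≤ 1 := by rwa [norm_star]
  set D := (1 - star u * u) with hD
  have hDs : ∀ ζ, (1 - u * star u) ζ = ζ - u (star u ζ) := fun ζ => rfl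
  have hadj : ∀ α β, ⟪u α, β⟫_ℂ = ⟪α, star u β⟫_ℂ := fun α β =>
    (ContinuousLinearMap.adjoint_inner_right u α β).symm
  have hadj' : ∀ α β, ⟪star u α, β⟫_ℂ = ⟪α, u β⟫_ℂ := fun α β =>
    ContinuousLinearMap.adjoint_inner_left u β α
  have happ : ∀ (a : H →L[ℂ] H) ζ, ‖a‖ ≤ 1 → ‖a ζ‖ ≤ ‖ζ‖ := fun a ζ ha => by
    simpa using a.le_of_opNorm_le ha ζ
  set η := c (D ξ) with hη
  have hηb : ‖η‖ ≤ 1 / 3 * ‖D ξ‖ := c.le_of_opNorm_le hc _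
  have hDξ : D ξ = ξ - star u (u ξ) := rfl
  have h1 : ‖D ξ‖ ^ 2 ≤ ‖ξ‖ ^ 2 - ‖u ξ‖ ^ 2 := by
    rw [hDξ, norm_sub_sq (𝕜 := ℂ), ← hadj, inner_self_eq_norm_sq_to_K]
    have h2 : ‖star u (u ξ)‖ ≤ ‖u ξ‖ := happ _ _ hu'
    have h3 : RCLike.re ((‖u ξ‖ : ℂ) ^ 2) = ‖u ξ‖ ^ 2 := by norm_cast
    have h4 : ‖star u (u ξ)‖ ^ 2 ≤ ‖u ξ‖ ^ 2 := by gcongr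
    simp only [Complex.coe_algebraMap] at *
    rw [h3]; linarith
  have h2 : ‖(1 - u * star u) η‖ ≤ ‖η‖ := by
    have h5 : ‖(1 - u * star u) η‖ ^ 2 ≤ ‖η‖ ^ 2 := by
      rw [hDs, norm_sub_sq (𝕜 := ℂ), ← hadj', inner_self_eq_norm_sq_to_K]
      have h2 : ‖u (star u η)‖ ≤ ‖star u η‖ := happ _ _ hu
      have h3 : RCLike.re ((‖star u η‖ : ℂ) ^ 2) = ‖star u η‖ ^ 2 := by norm_cast
      have h4 : ‖u (star u η)‖ ^ 2 ≤ ‖star u η‖ ^ 2 := by gcongr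
      simp only [Complex.coe_algebraMap] at *
      rw [h3]; nlinarith [sq_nonneg ‖star u η‖]
    exact (sq_le_sq₀ (norm_nonneg _) (norm_nonneg _)).1 h5
  have h3 : RCLike.re ⟪u ξ, (1 - u * star u) η⟫_ℂ ≤ ‖D ξ‖ * ‖η‖ := by
    have : ⟪u ξ, (1 - u * star u) η⟫_ℂ = ⟪u (D ξ), η⟫_ℂ := by
      rw [hDs, hDξ, map_sub, inner_sub_right, inner_sub_left, hadj (star u (u ξ)), hadj']
    rw [this]
    refine (RCLike.re_le_norm _).trans ((norm_inner_le_norm _ _).trans ?_)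
    gcongr
    exact happ _ _ hu
  have h4 : ‖u ξ + (1 - u * star u) η‖ ^ 2 ≤ ‖ξ‖ ^ 2 := by
    rw [norm_add_sq (𝕜 := ℂ)]
    have h6 : ‖(1 - u * star u) η‖ ^ 2 ≤ (1 / 3 * ‖D ξ‖) ^ 2 := by
      gcongr; exact h2.trans hηb
    have h7 : ‖D ξ‖ * ‖η‖ ≤ ‖D ξ‖ * (1 / 3 * ‖D ξ‖) := by gcongr
    nlinarith [sq_nonneg ‖D ξ‖]
  rw [one_mul]
  exact (sq_le_sq₀ (norm_nonneg _) (norm_nonneg _)).1 h4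

/-- An extreme point of the unit ball of `B(H)` is an isometry or a co-isometry. -/
theorem isometry_or_coisometry_of_mem_extremePoints {u : H →L[ℂ] H}
    (hu : u ∈ (Metric.closedBall (0 : H →L[ℂ] H) 1).extremePoints ℝ) :
    star u * u = 1 ∨ u * star u = 1 := by
  have hu1 : ‖u‖ ≤ 1 := by simpa using hu.1
  have key : ∀ c : H →L[ℂ] H, ‖c‖ ≤ 1 / 3 → (1 - u * star u) * c * (1 - star u * u) = 0 := by
    intro c hc
    set p := (1 - u * star u) * c * (1 - star u * u) with hp
    have h1 : u + p ∈ Metric.closedBall (0 : H →L[ℂ] H) 1 := by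
      simpa using norm_add_defect_le_one hu1 hc
    have h2 : u - p ∈ Metric.closedBall (0 : H →L[ℂ] H) 1 := by
      have := norm_add_defect_le_one (c := -c) hu1 (by simpa using hc)
      simpa [hp, sub_eq_add_neg] using this
    have h3 : u ∈ openSegment ℝ (u + p) (u - p) :=
      ⟨1 / 2, 1 / 2, by norm_num, by norm_num, by norm_num, by module⟩
    simpa using hu.2 h1 h2 h3
  by_contra! hcon
  obtain ⟨h1, h2⟩ := hcon
  have h1' : 1 - star u * u ≠ 0 := fun h => h1 (sub_eq_zero.1 h).symm
  have h2' : 1 - u * star u ≠ 0 := fun h => h2 (sub_eq_zero.1 h).symm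
  obtain ⟨ξ, hξ⟩ : ∃ ξ, (1 - star u * u) ξ ≠ 0 := by
    by_contra! h; exact h1' (ContinuousLinearMap.ext h)
  obtain ⟨η, hη⟩ : ∃ η, (1 - u * star u) η ≠ 0 := by
    by_contra! h; exact h2' (ContinuousLinearMap.ext h)
  set ζ := (1 - star u * u) ξ with hζ
  set c : H →L[ℂ] H := InnerProductSpace.rankOne ℂ η ζ with hcdef
  have hc0 : c ζ = ⟪ζ, ζ⟫_ℂ • η := by simp [hcdef]
  obtain ⟨r, hr0, hr⟩ : ∃ r : ℝ, 0 < r ∧ ‖r • c‖ ≤ 1 / 3 := by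
    refine ⟨1 / (3 * (‖c‖ + 1)), by positivity, ?_⟩
    rw [norm_smul, Real.norm_of_nonneg (by positivity), div_mul_eq_mul_div,
      div_le_div_iff₀ (by positivity) (by norm_num)]
    nlinarith [norm_nonneg c]
  have h5 := congrArg (fun a : H →L[ℂ] H => a ξ) (key _ hr)
  have h6 : (1 - u * star u) (r • c ζ) = 0 := h5
  rw [hc0, ContinuousLinearMap.map_smul_of_tower, map_smul, smul_eq_zero, smul_eq_zero] at h6
  rcases h6 with h | h | h
  · exact hr0.ne' h
  · exact hξ (inner_self_eq_zero.1 h)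
  · exact hη h
end

section
variable {H : Type*} [NormedAddCommGroup H] [InnerProductSpace ℂ H]

/-- **Parseval's identity**. -/
theorem HilbertBasis.hasSum_norm_inner_sq (b : HilbertBasis ℕ ℂ H) (v : H) :
    HasSum (fun n => ‖⟪b n, v⟫_ℂ‖ ^ 2) (‖v‖ ^ 2) := by
  have h := b.hasSum_inner_mul_inner v v
  rw [inner_self_eq_norm_sq_to_K] at h
  rw [← Complex.hasSum_ofReal]
  convert! h using 1
  · ext n
    rw [← inner_conj_symm v, RCLike.conj_mul]
    norm_cast
  · norm_cast

theorem HilbertBasis.summable_norm_inner_sq_prod (b : HilbertBasis ℕ ℂ H)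
    {f : ℕ → H} (hf : Summable fun m => ‖f m‖ ^ 2) :
    Summable fun z : ℕ × ℕ => ‖⟪b z.2, f z.1⟫_ℂ‖ ^ 2 := by
  rw [summable_prod_of_nonneg (fun _ => by positivity)]
  refine ⟨fun m => (b.hasSum_norm_inner_sq (f m)).summable, ?_⟩
  simpa only [(b.hasSum_norm_inner_sq _).tsum_eq] using hf

theorem norm_inner_apply_le_of_norm_le {p q : H} (hpq : ‖p‖ ≤ ‖q‖) (φ : H →L[ℂ] H) :
    ‖⟪q, φ p⟫_ℂ‖ ≤ ‖φ‖ * ‖q‖ ^ 2 :=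
  calc ‖⟪q, φ p⟫_ℂ‖ ≤ ‖q‖ * (‖φ‖ * ‖p‖) :=
        (norm_inner_le_norm _ _).trans (by gcongr; exact φ.le_opNorm _)
    _ ≤ ‖q‖ * (‖φ‖ * ‖q‖) := by gcongr
    _ = ‖φ‖ * ‖q‖ ^ 2 := by ring

end

section
variable {H : Type*} [NormedAddCommGroup H] [InnerProductSpace ℂ H] [CompleteSpace H]

/-- If `‖T ξ‖ ≤ ‖S ξ‖` for all `ξ`, then `T` factors as a contraction composed with `S`. -/
theorem exists_contraction_mul_eq {T S : H →L[ℂ] H} (h : ∀ ξ, ‖T ξ‖ ≤ ‖S ξ‖) :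
    ∃ w : H →L[ℂ] H, ‖w‖ ≤ 1 ∧ w * S = T := by
  let M : Submodule ℂ H := (LinearMap.range (S : H →ₗ[ℂ] H)).topologicalClosure
  have hM : ∀ ξ, S ξ ∈ M := fun ξ => Submodule.le_topologicalClosure _ ⟨ξ, rfl⟩
  let e : H →ₗ[ℂ] M := (S : H →ₗ[ℂ] H).codRestrict M hM
  have hd : DenseRange e := by
    rw [DenseRange, Subtype.dense_iff]
    intro x hx
    have : ((↑) '' Set.range e : Set H) = Set.range S := by
      rw [← Set.range_comp]; rfl
    refine Eq.mpr (congrArg (fun A : Set H => x ∈ closure A) this) ?_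
    exact hx
  have hn : ∀ ξ, ‖(T : H →ₗ[ℂ] H) ξ‖ ≤ 1 * ‖e ξ‖ := fun ξ => by simpa [e] using h ξ
  have : CompleteSpace M := (Submodule.isClosed_topologicalClosure _).completeSpace_coe
  refine ⟨((T : H →ₗ[ℂ] H).extendOfNorm e).comp M.orthogonalProjectionOnto, ?_, ?_⟩
  · refine (ContinuousLinearMap.opNorm_comp_le _ _).trans ?_
    exact mul_le_one₀ (LinearMap.opNorm_extendOfNorm_le hd zero_le_one hn) (norm_nonneg _)
      (Submodule.orthogonalProjectionOnto_norm_le M)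
  · ext ξ
    have h1 : M.orthogonalProjectionOnto (S ξ) = e ξ :=
      Submodule.orthogonalProjectionOnto_mem_subspace_eq_self (K := M) ⟨S ξ, hM ξ⟩
    change (T : H →ₗ[ℂ] H).extendOfNorm e (M.orthogonalProjectionOnto (S ξ)) = T ξ
    rw [h1, LinearMap.extendOfNorm_eq hd ⟨1, hn⟩]
    rfl

theorem opAbs_nonneg (a : H →L[ℂ] H) : 0 ≤ opAbs a := CFC.sqrt_nonneg _

theorem opAbs_mul_self (a : H →L[ℂ] H) : opAbs a * opAbs a = star a * a :=
  CFC.sqrt_mul_sqrt_self _ (star_mul_self_nonneg a)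

theorem norm_opAbs_apply (a : H →L[ℂ] H) (ξ : H) : ‖opAbs a ξ‖ = ‖a ξ‖ := by
  have h : star (opAbs a) * opAbs a = star a * a := by
    rw [(opAbs_nonneg a).isSelfAdjoint.star_eq, opAbs_mul_self]
  have key : ∀ c : H →L[ℂ] H, ⟪ξ, (star c * c) ξ⟫_ℂ = (‖c ξ‖ ^ 2 : ℝ) := fun c => by
    have : ⟪ξ, (star c * c) ξ⟫_ℂ = ⟪c ξ, c ξ⟫_ℂ := ContinuousLinearMap.adjoint_inner_right c ξ (c ξ)
    rw [this, inner_self_eq_norm_sq_to_K]; norm_cast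
  have h2 := key (opAbs a)
  rw [h, key a] at h2
  have h3 := Complex.ofReal_injective h2
  exact (((sq_eq_sq₀ (norm_nonneg _) (norm_nonneg _)).1 h3)).symm

/-- Polar decomposition, in the form `a = w |a|` with `w` a contraction. -/
theorem exists_contraction_mul_opAbs (a : H →L[ℂ] H) :
    ∃ w : H →L[ℂ] H, ‖w‖ ≤ 1 ∧ w * opAbs a = a :=
  exists_contraction_mul_eq fun ξ => (norm_opAbs_apply a ξ).ge

/-- Polar decomposition, in the form `φ a = |a|` with `φ` a contraction. -/
theorem exists_contraction_mul_eq_opAbs (a : H →L[ℂ] H) :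
    ∃ φ : H →L[ℂ] H, ‖φ‖ ≤ 1 ∧ φ * a = opAbs a :=
  exists_contraction_mul_eq fun ξ => (norm_opAbs_apply a ξ).le

variable {b : HilbertBasis ℕ ℂ H}

theorem re_inner_opAbs_eq (a : H →L[ℂ] H) (ξ : H) :
    ⟪ξ, opAbs a ξ⟫_ℂ = ((⟪ξ, opAbs a ξ⟫_ℂ).re : ℂ) := by
  have h := ((ContinuousLinearMap.nonneg_iff_isPositive _).1 (opAbs_nonneg a)).inner_nonneg_right ξ
  exact (Complex.eq_re_of_ofReal_le h)

/-- A trace class operator is, weakly, an absolutely convergent sum of rank one operators, and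
this sum computes all the traces `Tr (φ a)`. -/
theorem IsTraceClass.exists_hasSum {a : H →L[ℂ] H} (ha : IsTraceClass b a) :
    ∃ p q : ℕ → H, HasSum (fun m => ‖q m‖ ^ 2) (traceNorm b a) ∧ (∀ m, ‖p m‖ ≤ ‖q m‖) ∧
      ∀ φ : H →L[ℂ] H, HasSum (fun n => ⟪b n, (φ * a) (b n)⟫_ℂ) (∑' m, ⟪q m, φ (p m)⟫_ℂ) := by
  obtain ⟨w, hw, hwa⟩ := exists_contraction_mul_opAbs a
  set s := CFC.sqrt (opAbs a) with hs
  have hss : s * s = opAbs a := CFC.sqrt_mul_sqrt_self _ (opAbs_nonneg a)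
  have hsa : ∀ α β, ⟪s α, β⟫_ℂ = ⟪α, s β⟫_ℂ := fun α β => by
    have h1 : star s = s := (CFC.sqrt_nonneg (opAbs a)).isSelfAdjoint.star_eq
    conv_lhs => rw [← h1]
    exact ContinuousLinearMap.adjoint_inner_left s β α
  have hsq : ∀ ξ, (⟪ξ, opAbs a ξ⟫_ℂ).re = ‖s ξ‖ ^ 2 := fun ξ => by
    rw [← hss, mul_apply_eq_comp, ← hsa, inner_self_eq_norm_sq_to_K]
    norm_cast
  have hsum : HasSum (fun m => ‖s (b m)‖ ^ 2) (traceNorm b a) := by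
    have := Summable.hasSum ha
    simpa only [hsq, traceNorm] using! this
  refine ⟨fun m => w (s (b m)), fun m => s (b m), hsum,
    fun m => by simpa using w.le_of_opNorm_le hw (s (b m)), fun φ => ?_⟩
  set c := φ * w with hc
  have hcs : Summable fun m => ‖c (s (b m))‖ ^ 2 := by
    refine (hsum.summable.mul_left (‖c‖ ^ 2)).of_nonneg_of_le (fun _ => by positivity) fun m => ?_
    rw [← mul_pow]
    gcongr
    exact c.le_opNorm _
  let F : ℕ × ℕ → ℂ := fun z => ⟪s (b z.1), b z.2⟫_ℂ * ⟪b z.2, c (s (b z.1))⟫_ℂ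
  have hF : Summable F := by
    refine .of_norm_bounded ((b.summable_norm_inner_sq_prod hsum.summable).add
      (b.summable_norm_inner_sq_prod hcs)) fun z => ?_
    rw [norm_mul, norm_inner_symm]
    nlinarith [two_mul_le_add_sq ‖⟪b z.2, s (b z.1)⟫_ℂ‖ ‖⟪b z.2, c (s (b z.1))⟫_ℂ‖,
      mul_nonneg (norm_nonneg ⟪b z.2, s (b z.1)⟫_ℂ) (norm_nonneg ⟪b z.2, c (s (b z.1))⟫_ℂ)]
  have h1 : HasSum (fun m => ⟪s (b m), c (s (b m))⟫_ℂ) (∑' z, F z) :=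
    hF.hasSum.prod_fiberwise fun m => b.hasSum_inner_mul_inner (s (b m)) (c (s (b m)))
  have hF' : HasSum (fun z : ℕ × ℕ => F z.swap) (∑' z, F z) :=
    (Equiv.prodComm ℕ ℕ).hasSum_iff.2 hF.hasSum
  have h2 : HasSum (fun n => ⟪b n, (φ * a) (b n)⟫_ℂ) (∑' z, F z) := by
    refine hF'.prod_fiberwise fun n => ?_
    have h3 := b.hasSum_inner_mul_inner (s (star c (b n))) (s (b n))
    have h4 : ∀ v, ⟪s (star c (b n)), v⟫_ℂ = ⟪b n, c (s v)⟫_ℂ := fun v => by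
      rw [hsa]
      exact ContinuousLinearMap.adjoint_inner_left c (s v) (b n)
    have h5 : c (s (s (b n))) = (φ * a) (b n) := by
      have : c * (s * s) = φ * a := by rw [hss, hc, mul_assoc, hwa]
      exact congrArg (fun t : H →L[ℂ] H => t (b n)) this
    rw [h4, h5] at h3
    convert! h3 using 1
    ext m
    rw [h4, mul_comm, ← hsa]
    rfl
  rw [show (∑' m, ⟪s (b m), φ (w (s (b m)))⟫_ℂ) = ∑' z, F z from h1.tsum_eq]
  exact h2

theorem IsTraceClass.summable {a : H →L[ℂ] H} (ha : IsTraceClass b a) (φ : H →L[ℂ] H) :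
    Summable fun n => ⟪b n, (φ * a) (b n)⟫_ℂ := by
  obtain ⟨p, q, -, -, h⟩ := ha.exists_hasSum
  exact (h φ).summable

theorem IsTraceClass.of_summable {a : H →L[ℂ] H}
    (h : ∀ φ : H →L[ℂ] H, Summable fun n => ⟪b n, (φ * a) (b n)⟫_ℂ) : IsTraceClass b a := by
  obtain ⟨φ, -, hφ⟩ := exists_contraction_mul_eq_opAbs a
  have := h φ
  rw [hφ] at this
  exact (Complex.hasSum_re this.hasSum).summable

theorem exists_traceAlong_eq_traceNorm (b : HilbertBasis ℕ ℂ H) (a : H →L[ℂ] H) :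
    ∃ φ : H →L[ℂ] H, ‖φ‖ ≤ 1 ∧ traceAlong b (φ * a) = traceNorm b a := by
  obtain ⟨φ, h1, hφ⟩ := exists_contraction_mul_eq_opAbs a
  refine ⟨φ, h1, ?_⟩
  rw [hφ, traceAlong, traceNorm, Complex.ofReal_tsum]
  exact tsum_congr fun n => re_inner_opAbs_eq a (b n)

theorem IsTraceClass.norm_traceAlong_le {a : H →L[ℂ] H} (ha : IsTraceClass b a)
    (φ : H →L[ℂ] H) : ‖traceAlong b (φ * a)‖ ≤ ‖φ‖ * traceNorm b a := by
  obtain ⟨p, q, hq, hpq, h⟩ := ha.exists_hasSum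
  rw [traceAlong, (h φ).tsum_eq]
  exact tsum_of_norm_bounded (hq.mul_left ‖φ‖) fun m => norm_inner_apply_le_of_norm_le (hpq m) φ

theorem IsTraceClass.traceNorm_nonneg {a : H →L[ℂ] H} (ha : IsTraceClass b a) :
    0 ≤ traceNorm b a := by
  obtain ⟨p, q, hq, -, -⟩ := ha.exists_hasSum
  exact hq.nonneg fun _ => by positivity

theorem IsTraceClass.opNorm_le_traceNorm {a : H →L[ℂ] H} (ha : IsTraceClass b a) :
    ‖a‖ ≤ traceNorm b a := by
  have h0 := ha.traceNorm_nonneg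
  refine a.opNorm_le_bound h0 fun η => ?_
  have h1 := ha.norm_traceAlong_le (InnerProductSpace.rankOne ℂ η (a η))
  have h2 : traceAlong b (InnerProductSpace.rankOne ℂ η (a η) * a) = ⟪a η, a η⟫_ℂ := by
    have h3 := b.hasSum_inner_mul_inner (star a (a η)) η
    have h4 : ∀ v, ⟪star a (a η), v⟫_ℂ = ⟪a η, a v⟫_ℂ := fun v =>
      ContinuousLinearMap.adjoint_inner_left a v (a η)
    simp only [h4] at h3
    rw [← h3.tsum_eq, traceAlong]
    refine tsum_congr fun n => ?_
    simp
  rw [h2, inner_self_eq_norm_sq_to_K, InnerProductSpace.norm_rankOne] at h1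
  rcases eq_or_ne (a η) 0 with h | h
  · rw [h, norm_zero]; positivity
  · have h5 : ‖a η‖ ^ 2 ≤ ‖η‖ * ‖a η‖ * traceNorm b a := by simpa using h1
    have h6 : 0 < ‖a η‖ := norm_pos_iff.2 h
    refine le_of_mul_le_mul_right ?_ h6
    linarith

variable (b) in
/-- The trace class operators, as a subspace of `B(H)`. -/
def traceClass : Submodule ℂ (H →L[ℂ] H) where
  carrier := {a | IsTraceClass b a}
  zero_mem' := .of_summable fun φ => by simp [summable_zero]
  add_mem' {a c} ha hc := .of_summable fun φ => by
    simpa [mul_add, inner_add_right] using (IsTraceClass.summable ha φ).add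
      (IsTraceClass.summable hc φ)
  smul_mem' r a ha := .of_summable fun φ => by
    simpa [inner_smul_right] using (IsTraceClass.summable ha φ).mul_left r

variable (b) in
/-- The pairing `(φ, a) ↦ Tr (φ a)` between `B(H)` and the trace class operators. -/
noncomputable def tracePairing : (H →L[ℂ] H) →ₗ[ℂ] traceClass b →ₗ[ℂ] ℂ :=
  LinearMap.mk₂ ℂ (fun φ a => traceAlong b (φ * a))
    (fun φ ψ a => by
      simp only [traceAlong, add_mul, add_apply, inner_add_right]
      exact (IsTraceClass.summable a.2 φ).tsum_add (IsTraceClass.summable a.2 ψ))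
    (fun r φ a => by
      simp only [traceAlong, smul_mul_assoc, smul_apply, inner_smul_right, smul_eq_mul]
      exact tsum_mul_left)
    (fun φ a c => by
      simp only [traceAlong, Submodule.coe_add, mul_add, add_apply, inner_add_right]
      exact (IsTraceClass.summable a.2 φ).tsum_add (IsTraceClass.summable c.2 φ))
    (fun r φ a => by
      simp only [traceAlong, Submodule.coe_smul, mul_smul_comm, smul_apply, inner_smul_right,
        smul_eq_mul]
      exact tsum_mul_left)

theorem tracePairing_apply (φ : H →L[ℂ] H) (a : traceClass b) :
    tracePairing b φ a = traceAlong b (φ * (a : H →L[ℂ] H)) := rfl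
end

section
variable {H : Type*} [NormedAddCommGroup H] [InnerProductSpace ℂ H] [CompleteSpace H]

/-- The unit ball of `B(H)` is compact in the weak operator topology: its image in the space of
all functions `H → H → ℂ` is compact in the topology of pointwise convergence. -/
theorem isCompact_image_inner_unitBall :
    IsCompact ((fun (φ : H →L[ℂ] H) (ξ η : H) => ⟪ξ, φ η⟫_ℂ) ''
      Metric.closedBall (0 : H →L[ℂ] H) 1) := by
  let P : Set (H → H → ℂ) := Set.univ.pi fun ξ => Set.univ.pi fun η =>
    Metric.closedBall (0 : ℂ) (‖ξ‖ * ‖η‖)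
  have hP : IsCompact P := isCompact_univ_pi fun ξ => isCompact_univ_pi fun η =>
    isCompact_closedBall _ _
  let Q : Set (H → H → ℂ) := {f | (∀ ξ ξ' η, f (ξ + ξ') η = f ξ η + f ξ' η) ∧
    (∀ (r : ℂ) ξ η, f (r • ξ) η = starRingEnd ℂ r * f ξ η) ∧
    (∀ ξ η η', f ξ (η + η') = f ξ η + f ξ η') ∧ ∀ (r : ℂ) ξ η, f ξ (r • η) = r * f ξ η}
  have hQ : IsClosed Q := by
    simp only [Q, Set.ofPred_and, Set.ofPred_forall]
    refine IsClosed.inter ?_ (IsClosed.inter ?_ (IsClosed.inter ?_ ?_)) <;>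
      exact isClosed_iInter fun _ => isClosed_iInter fun _ => isClosed_iInter fun _ =>
        isClosed_eq (by fun_prop) (by fun_prop)
  convert! hP.inter_right hQ using 1
  refine Set.Subset.antisymm ?_ ?_
  · rintro _ ⟨φ, hφ, rfl⟩
    refine ⟨fun ξ _ η _ => ?_, ?_, ?_, ?_, ?_⟩
    · rw [mem_closedBall_zero_iff] at hφ ⊢
      refine (norm_inner_le_norm _ _).trans ?_
      gcongr
      simpa using φ.le_of_opNorm_le hφ η
    · exact fun ξ ξ' η => inner_add_left _ _ _
    · exact fun c ξ η => inner_smul_left _ _ _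
    · exact fun ξ η η' => by simp only [map_add, inner_add_right]
    · exact fun c ξ η => by simp only [map_smul, inner_smul_right]
  · rintro f ⟨hfP, h1, h2, h3, h4⟩
    have hf : ∀ ξ η, ‖f ξ η‖ ≤ ‖ξ‖ * ‖η‖ := fun ξ η => by
      simpa using hfP ξ trivial η trivial
    let B : H →L⋆[ℂ] H →L[ℂ] ℂ := LinearMap.mkContinuous₂
      (LinearMap.mk₂'ₛₗ (starRingEnd ℂ) (RingHom.id ℂ) f h1 h2 h3 h4) 1
      (fun ξ η => by simpa using hf ξ η)
    let φ := ContinuousLinearMap.adjoint (InnerProductSpace.continuousLinearMapOfBilin B)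
    have hφ : ∀ ξ η, ⟪ξ, φ η⟫_ℂ = f ξ η := fun ξ η => by
      rw [ContinuousLinearMap.adjoint_inner_right,
        InnerProductSpace.continuousLinearMapOfBilin_apply]
      rfl
    refine ⟨φ, ?_, funext fun ξ => funext fun η => hφ ξ η⟩
    rw [mem_closedBall_zero_iff]
    refine φ.opNorm_le_bound zero_le_one fun η => ?_
    have h5 := hf (φ η) η
    rw [← hφ, inner_self_eq_norm_sq_to_K, one_mul] at *
    have h6 : ‖φ η‖ ^ 2 ≤ ‖φ η‖ * ‖η‖ := by simpa using h5
    rcases (norm_nonneg (φ η)).eq_or_lt with h | h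
    · rw [← h]; positivity
    · exact le_of_mul_le_mul_left (by linarith) h

variable {b : HilbertBasis ℕ ℂ H}

/-- The operator `φ` seen as the family of its matrix coefficients, together with the traces
`Tr (φ aᵢ)`. -/
noncomputable def coeffPairing {ι : Type*} (a : ι → traceClass b) :
    (H →L[ℂ] H) →ₗ[ℝ] (H → H → ℂ) × (ι → ℂ) where
  toFun φ := (fun ξ η => ⟪ξ, φ η⟫_ℂ, fun i => tracePairing b φ (a i))
  map_add' φ ψ := by
    refine Prod.ext (funext fun ξ => funext fun η => ?_) (funext fun i => ?_)
    · exact inner_add_right _ _ _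
    · simp only [map_add, LinearMap.add_apply, Prod.snd_add, Pi.add_apply]
  map_smul' r φ := by
    rw [show r • φ = (r : ℂ) • φ from (Complex.coe_smul r φ).symm]
    refine Prod.ext (funext fun ξ => funext fun η => ?_) (funext fun i => ?_)
    · simp
    · simp

theorem coeffPairing_injective {ι : Type*} (a : ι → traceClass b) :
    Function.Injective (coeffPairing a) := by
  intro φ ψ h
  ext η
  refine ext_inner_left ℂ fun ξ => ?_
  exact congrFun (congrFun (congrArg Prod.fst h) ξ) η

theorem isCompact_image_coeffPairing_unitBall {ι : Type*} (a : ι → traceClass b) :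
    IsCompact (coeffPairing a '' Metric.closedBall (0 : H →L[ℂ] H) 1) := by
  have hfac := fun i => IsTraceClass.exists_hasSum (a i).2
  choose p q hq hpq h using hfac
  let G : (H → H → ℂ) → (H → H → ℂ) × (ι → ℂ) := fun f => (f, fun i => ∑' m, f (q i m) (p i m))
  have hG : coeffPairing a = G ∘ fun (φ : H →L[ℂ] H) (ξ η : H) => ⟪ξ, φ η⟫_ℂ := by
    funext φ
    refine Prod.ext rfl (funext fun i => ?_)
    exact (h i φ).tsum_eq
  rw [hG, Set.image_comp]
  refine isCompact_image_inner_unitBall.image_of_continuousOn ?_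
  refine continuousOn_id.prodMk (continuousOn_pi.2 fun i => ?_)
  refine continuousOn_tsum (fun m => Continuous.continuousOn (by fun_prop)) (hq i).summable ?_
  rintro m _ ⟨φ, hφ, rfl⟩
  rw [mem_closedBall_zero_iff] at hφ
  exact (norm_inner_apply_le_of_norm_le (hpq i m) φ).trans
    (mul_le_of_le_one_left (by positivity) hφ)

theorem norm_tracePairing_le {φ : H →L[ℂ] H} (hφ : ‖φ‖ ≤ 1) (a : traceClass b) :
    ‖tracePairing b φ a‖ ≤ traceNorm b (a : H →L[ℂ] H) :=
  (IsTraceClass.norm_traceAlong_le a.2 φ).trans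
    (mul_le_of_le_one_left (IsTraceClass.traceNorm_nonneg a.2) hφ)

theorem traceNorm_le_iff (a : traceClass b) (r : ℝ) :
    traceNorm b (a : H →L[ℂ] H) ≤ r ↔ ∀ φ : H →L[ℂ] H, ‖φ‖ ≤ 1 → (tracePairing b φ a).re ≤ r := by
  refine ⟨fun h φ hφ => ((Complex.re_le_norm _).trans (norm_tracePairing_le hφ a)).trans h,
    fun h => ?_⟩
  obtain ⟨φ, hφ, he⟩ := exists_traceAlong_eq_traceNorm b (a : H →L[ℂ] H)
  simpa [tracePairing_apply, he] using h φ hφ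

/-- If `y` has minimal trace norm in `y + span v`, some contraction `φ` satisfies
`Tr (φ y) = ‖y‖₁` and annihilates `span v`. -/
theorem exists_contraction_annihilator {ι : Type*} [Fintype ι] (y : traceClass b)
    (v : ι → traceClass b)
    (hmin : ∀ c : ι → ℂ, traceNorm b (y : H →L[ℂ] H) ≤
      traceNorm b ((y + ∑ i, c i • v i : traceClass b) : H →L[ℂ] H)) :
    ∃ φ : H →L[ℂ] H, ‖φ‖ ≤ 1 ∧ tracePairing b φ y = traceNorm b (y : H →L[ℂ] H) ∧
      ∀ i, tracePairing b φ (v i) = 0 := by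
  classical
  set d := traceNorm b (y : H →L[ℂ] H) with hd
  let a : Option ι → traceClass b := fun o => o.elim y v
  let K : Set (Option ι → ℂ) :=
    Prod.snd '' (coeffPairing a '' Metric.closedBall (0 : H →L[ℂ] H) 1)
  have hK : IsCompact K := (isCompact_image_coeffPairing_unitBall a).image continuous_snd
  have hKc : Convex ℝ K := by
    have := ((convex_closedBall (0 : H →L[ℂ] H) 1).linear_image (coeffPairing a)).linear_image
      (LinearMap.snd ℝ (H → H → ℂ) (Option ι → ℂ))
    exact this
  let t : Option ι → ℂ := fun o => o.elim (d : ℂ) 0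
  suffices ht : t ∈ K by
    obtain ⟨_, ⟨φ, hφ, rfl⟩, he⟩ := ht
    rw [mem_closedBall_zero_iff] at hφ
    exact ⟨φ, hφ, congrFun he none, fun i => congrFun he (some i)⟩
  by_contra ht
  obtain ⟨f, r, hf, hr⟩ := RCLike.geometric_hahn_banach_closed_point (𝕜 := ℂ) hKc hK.isClosed ht
  let α : Option ι → ℂ := fun o => f (Pi.single o 1)
  have hfα : ∀ z, f z = α none * z none + ∑ i, α (some i) * z (some i) := fun z => by
    conv_lhs => rw [pi_eq_sum_univ' z]
    simp [map_sum, α, mul_comm, Fintype.sum_option]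
  have hφr : ∀ φ : H →L[ℂ] H, ‖φ‖ ≤ 1 →
      (tracePairing b φ (α none • y + ∑ i, α (some i) • v i)).re < r := fun φ hφ => by
    have := hf _ ⟨_, ⟨φ, mem_closedBall_zero_iff.2 hφ, rfl⟩, rfl⟩
    rw [hfα] at this
    simpa [coeffPairing, a] using this
  have hrt : r < (α none * d).re := by
    rw [hfα] at hr
    simpa [t] using hr
  rcases eq_or_ne (α none) 0 with h0 | h0
  · have := hφr 0 (by simp)
    simp [h0] at this hrt
    linarith
  · obtain ⟨φ, hφ, he⟩ := exists_traceAlong_eq_traceNorm b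
      ((y + ∑ i, ((α none)⁻¹ * α (some i)) • v i : traceClass b) : H →L[ℂ] H)
    rw [← tracePairing_apply] at he
    have hα : 0 < ‖α none‖ := norm_pos_iff.2 h0
    let θ : ℂ := starRingEnd ℂ (α none) / ‖α none‖
    have hθ : ‖θ‖ = 1 := by
      simp [θ, hα.ne']
    have hθα : θ * α none = ‖α none‖ := by
      have : (‖α none‖ : ℂ) ≠ 0 := by exact_mod_cast hα.ne'
      simp only [θ]
      rw [div_mul_eq_mul_div, RCLike.conj_mul, div_eq_iff this]
      simp [sq]
    have h1 := hφr (θ • φ) (by rw [norm_smul, hθ, one_mul]; exact hφ)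
    have h2 : α none • y + ∑ i, α (some i) • v i =
        α none • (y + ∑ i, ((α none)⁻¹ * α (some i)) • v i) := by
      rw [smul_add, Finset.smul_sum]
      simp [smul_smul, mul_inv_cancel_left₀ h0]
    rw [h2, map_smul, map_smul, LinearMap.smul_apply, he, smul_smul, mul_comm (α none), hθα,
      smul_eq_mul, ← Complex.ofReal_mul, Complex.ofReal_re] at h1
    have h3 := hmin fun i => (α none)⁻¹ * α (some i)
    have h4 : (α none * d).re ≤ ‖α none‖ * d := by
      rw [Complex.re_mul_ofReal]
      exact mul_le_mul_of_nonneg_right (Complex.re_le_norm _) (IsTraceClass.traceNorm_nonneg y.2)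
    have h5 := mul_le_mul_of_nonneg_left h3 hα.le
    linarith

/-- A contraction which attains `‖y‖₁` at `y` and annihilates `m` trace class operators can be
replaced, in its values on these operators, by a convex combination of at most `2 m + 1`
isometries and co-isometries. -/
theorem exists_convex_combination_isometries {ι : Type*} [Fintype ι] (y : traceClass b)
    (v : ι → traceClass b) {φ : H →L[ℂ] H} (hφ : ‖φ‖ ≤ 1)
    (hy : tracePairing b φ y = traceNorm b (y : H →L[ℂ] H))
    (hv : ∀ i, tracePairing b φ (v i) = 0) :
    ∃ (k : ℕ) (lam : Fin k → ℝ) (u : Fin k → (H →L[ℂ] H)), k ≤ 2 * Fintype.card ι + 1 ∧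
      (∀ i, 0 < lam i) ∧ ∑ i, lam i = 1 ∧ (∀ i, star (u i) * u i = 1 ∨ u i * star (u i) = 1) ∧
      (∀ i, tracePairing b (u i) y = traceNorm b (y : H →L[ℂ] H)) ∧
      ∀ j, ∑ i, (lam i : ℂ) * tracePairing b (u i) (v j) = 0 := by
  set d := traceNorm b (y : H →L[ℂ] H) with hd
  let a : Option ι → traceClass b := fun o => o.elim y v
  let F : Set (H →L[ℂ] H) := {ψ ∈ Metric.closedBall (0 : H →L[ℂ] H) 1 | tracePairing b ψ y = d}
  have hFs : coeffPairing a '' F =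
      coeffPairing a '' Metric.closedBall (0 : H →L[ℂ] H) 1 ∩ {z | z.2 none = (d : ℂ)} := by
    ext z
    constructor
    · rintro ⟨ψ, hψ, rfl⟩
      exact ⟨⟨ψ, hψ.1, rfl⟩, hψ.2⟩
    · rintro ⟨⟨ψ, hψ, rfl⟩, hz⟩
      exact ⟨ψ, ⟨hψ, hz⟩, rfl⟩
  have hs : IsCompact (coeffPairing a '' F) := by
    rw [hFs]
    exact (isCompact_image_coeffPairing_unitBall a).inter_right
      (isClosed_eq (by fun_prop) continuous_const)
  have hpair_smul : ∀ (r : ℝ) ψ (c : traceClass b),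
      tracePairing b (r • ψ) c = r * tracePairing b ψ c := fun r ψ c => by
    have h : r • ψ = (r : ℂ) • ψ := (Complex.coe_smul r ψ).symm
    rw [h, map_smul, LinearMap.smul_apply, smul_eq_mul]
  have hFc : Convex ℝ F := by
    intro ψ hψ χ hχ s t hs ht hst
    refine ⟨convex_closedBall _ _ hψ.1 hχ.1 hs ht hst, ?_⟩
    rw [map_add, LinearMap.add_apply, hpair_smul, hpair_smul, hψ.2, hχ.2, ← add_mul]
    norm_cast
    rw [hst, one_mul]
  let T : ((H → H → ℂ) × (Option ι → ℂ)) →L[ℝ] (ι → ℂ) :=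
    { toFun := fun z i => z.2 (some i)
      map_add' := fun _ _ => rfl
      map_smul' := fun _ _ => rfl
      cont := by fun_prop }
  let A := T.toContinuousAffineMap
  have hK : IsCompact (A '' (coeffPairing a '' F)) := hs.image A.continuous
  have hKc : Convex ℝ (A '' (coeffPairing a '' F)) :=
    (hFc.linear_image _).linear_image T.toLinearMap
  have h0 : (0 : ι → ℂ) ∈ A '' (coeffPairing a '' F) :=
    ⟨_, ⟨φ, ⟨mem_closedBall_zero_iff.2 hφ, hy⟩, rfl⟩, funext hv⟩
  obtain ⟨k, lam, z, hk, hlam, hsum, hz, hlz⟩ := hK.exists_convex_combination_extremePoints hKc h0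
  have hext : ∀ i, ∃ u : H →L[ℂ] H, (star u * u = 1 ∨ u * star u = 1) ∧
      tracePairing b u y = d ∧ ∀ j, tracePairing b u (v j) = z i j := by
    intro i
    obtain ⟨e, he, hez⟩ := surjOn_extremePoints_image A hs (hz i)
    obtain ⟨u, hu, rfl⟩ := he.1
    refine ⟨u, isometry_or_coisometry_of_mem_extremePoints ⟨hu.1, ?_⟩, hu.2, congrFun hez⟩
    intro ψ hψ χ hχ hseg
    obtain ⟨s, t, hs0, ht0, hst, hu'⟩ := hseg
    have hψ1 := norm_tracePairing_le (mem_closedBall_zero_iff.1 hψ) y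
    have hχ1 := norm_tracePairing_le (mem_closedBall_zero_iff.1 hχ) y
    have hcomb : s * (tracePairing b ψ y).re + t * (tracePairing b χ y).re = d := by
      have h := hu.2
      rw [← hu', map_add, LinearMap.add_apply, hpair_smul, hpair_smul] at h
      simpa using congrArg Complex.re h
    rw [← hd] at hψ1 hχ1
    have hsd : s * d + t * d = d := by rw [← add_mul, hst, one_mul]
    have hψ2 := (Complex.re_le_norm _).trans hψ1
    have hχ2 := (Complex.re_le_norm _).trans hχ1
    have eq_of : ∀ w : ℂ, ‖w‖ ≤ d → w.re = d → w = d := fun w h1 h2 => by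
      have h3 : w.re = ‖w‖ := le_antisymm (Complex.re_le_norm w) (h2 ▸ h1)
      have h4 := Complex.re_eq_norm.1 h3
      rw [Complex.eq_re_of_ofReal_le h4, h2]
    have hψd : (tracePairing b ψ y).re = d := by
      refine le_antisymm hψ2 ?_
      by_contra! hlt
      linarith [mul_lt_mul_of_pos_left hlt hs0, mul_le_mul_of_nonneg_left hχ2 ht0.le]
    have hχd : (tracePairing b χ y).re = d := by
      refine le_antisymm hχ2 ?_
      by_contra! hlt
      linarith [mul_lt_mul_of_pos_left hlt ht0, mul_le_mul_of_nonneg_left hψ2 hs0.le]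
    refine coeffPairing_injective a (he.2 ⟨ψ, ⟨hψ, eq_of _ hψ1 hψd⟩, rfl⟩
      ⟨χ, ⟨hχ, eq_of _ hχ1 hχd⟩, rfl⟩ ⟨s, t, hs0, ht0, hst, ?_⟩)
    rw [← hu', map_add, map_smul, map_smul]
  choose u hu huy huv using hext
  refine ⟨k, lam, u, ?_, hlam, hsum, hu, huy, fun j => ?_⟩
  · simpa [Module.finrank_pi_fintype, Complex.finrank_real_complex, mul_comm] using hk
  · have := congrFun hlz j
    simpa [huv, Finset.sum_apply] using this

/-- A finite dimensional space of trace class operators contains a best approximation of any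
trace class operator. -/
theorem exists_traceNorm_sub_le {V : Submodule ℂ (H →L[ℂ] H)} [FiniteDimensional ℂ V]
    (hV : V ≤ traceClass b) (x : traceClass b) :
    ∃ v₀ : V, ∀ v : V, traceNorm b ((x : H →L[ℂ] H) - v₀) ≤ traceNorm b ((x : H →L[ℂ] H) - v) := by
  let g : V → ℝ := fun v => traceNorm b ((x : H →L[ℂ] H) - v)
  have hle : ∀ v : V, ‖v‖ ≤ g v + ‖(x : H →L[ℂ] H)‖ := fun v => by
    have h1 := IsTraceClass.opNorm_le_traceNorm (x - Submodule.inclusion hV v).2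
    have h2 := norm_sub_norm_le (v : H →L[ℂ] H) x
    rw [norm_sub_rev] at h2
    change ‖(x : H →L[ℂ] H) - v‖ ≤ g v at h1
    have h3 : ‖v‖ = ‖(v : H →L[ℂ] H)‖ := rfl
    linarith
  have hlsc : LowerSemicontinuous g := by
    rw [lowerSemicontinuous_iff_isClosed_preimage]
    intro r
    have : g ⁻¹' Set.Iic r = ⋂ (φ : H →L[ℂ] H) (_ : ‖φ‖ ≤ 1),
        {v | (tracePairing b φ (x - Submodule.inclusion hV v)).re ≤ r} := by
      ext v
      simpa using! traceNorm_le_iff (x - Submodule.inclusion hV v) r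
    rw [this]
    refine isClosed_iInter fun φ => isClosed_iInter fun _ => ?_
    have hc : Continuous fun v => tracePairing b φ (Submodule.inclusion hV v) :=
      ((tracePairing b φ).comp (Submodule.inclusion hV)).continuous_of_finiteDimensional
    simp only [map_sub]
    exact isClosed_le (Complex.continuous_re.comp (continuous_const.sub hc)) continuous_const
  have : ProperSpace V := FiniteDimensional.proper ℂ V
  set R := g 0 + ‖(x : H →L[ℂ] H)‖ with hR
  have h0 : (0 : V) ∈ Metric.closedBall (0 : V) R := by
    simpa using hle 0
  obtain ⟨v₀, -, hv₀⟩ := (hlsc.lowerSemicontinuousOn _).exists_isMinOn ⟨0, h0⟩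
    (isCompact_closedBall (0 : V) R)
  refine ⟨v₀, fun v => ?_⟩
  by_cases hv : v ∈ Metric.closedBall (0 : V) R
  · exact hv₀ hv
  · rw [mem_closedBall_zero_iff, not_le] at hv
    have h1 : g v₀ ≤ g 0 := hv₀ h0
    have h2 := hle v
    change g v₀ ≤ g v
    linarith

end

/-- For an `n`-dimensional subspace `V` of `L¹(B(H))` and trace
class `x ∉ V`, there are `k ≤ 2n+1` convex coefficients `λᵢ` and operators `uᵢ`,
each an isometry or a co-isometry, with `Σ λᵢ Tr(uᵢ x)` real and equal to
`dist₁(x, V)`, and `Σ λᵢ Tr(uᵢ v) = 0` for all `v ∈ V`. -/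
theorem dist1_convex_combination_isometries {H : Type*} [NormedAddCommGroup H]
    [InnerProductSpace ℂ H] [CompleteSpace H]
    (hinf : ¬FiniteDimensional ℂ H) (b : HilbertBasis ℕ ℂ H)
    (V : Submodule ℂ (H →L[ℂ] H)) [FiniteDimensional ℂ V]
    (n : ℕ) (hn : Module.finrank ℂ V = n) (hV : ∀ v ∈ V, IsTraceClass b v)
    (x : H →L[ℂ] H) (hxt : IsTraceClass b x) (hx : x ∉ V) :
    ∃ (k : ℕ) (lam : Fin k → ℝ) (u : Fin k → (H →L[ℂ] H)),
      1 ≤ k ∧ k ≤ 2 * n + 1 ∧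
      (∀ i, lam i ∈ Set.Icc (0 : ℝ) 1) ∧ (∑ i, lam i) = 1 ∧
      (∀ i, ContinuousLinearMap.adjoint (u i) * u i = 1 ∨
        u i * ContinuousLinearMap.adjoint (u i) = 1) ∧
      (∑ i, (lam i : ℂ) * traceAlong b (u i * x)) =
        ((sInf {r : ℝ | ∃ v ∈ V, r = traceNorm b (x - v)} : ℝ) : ℂ) ∧
      ∀ v ∈ V, (∑ i, (lam i : ℂ) * traceAlong b (u i * v)) = 0 := by
  have hVT : V ≤ traceClass b := hV
  let X : traceClass b := ⟨x, hxt⟩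
  obtain ⟨v₀, hv₀⟩ := exists_traceNorm_sub_le hVT X
  let e := Module.finBasisOfFinrankEq ℂ V hn
  let v : Fin n → traceClass b := fun i => Submodule.inclusion hVT (e i)
  let y : traceClass b := X - Submodule.inclusion hVT v₀
  have hbest : ∀ w : V, traceNorm b (y : H →L[ℂ] H) ≤
      traceNorm b ((X - Submodule.inclusion hVT w : traceClass b) : H →L[ℂ] H) := fun w => hv₀ w
  have hmin : ∀ c : Fin n → ℂ, traceNorm b (y : H →L[ℂ] H) ≤
      traceNorm b ((y + ∑ i, c i • v i : traceClass b) : H →L[ℂ] H) := fun c => by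
    have h : y + ∑ i, c i • v i = X - Submodule.inclusion hVT (v₀ - ∑ i, c i • e i) := by
      simp only [y, v, map_sub, map_sum, map_smul]
      abel
    rw [h]
    exact hbest (v₀ - ∑ i, c i • e i)
  obtain ⟨φ, hφ, hφy, hφv⟩ := exists_contraction_annihilator y v hmin
  obtain ⟨k, lam, u, hk, hlam, hsum, hu, huy, huv⟩ :=
    exists_convex_combination_isometries y v hφ hφy hφv
  have hann : ∀ w : V, ∑ i, (lam i : ℂ) * tracePairing b (u i) (Submodule.inclusion hVT w) = 0 := by
    intro w
    let L : V →ₗ[ℂ] ℂ :=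
      ∑ i, (lam i : ℂ) • (tracePairing b (u i)).comp (Submodule.inclusion hVT)
    have hL : L = 0 := e.ext fun j => by simpa [L, v] using huv j
    simpa [L] using congrArg (fun l : V →ₗ[ℂ] ℂ => l w) hL
  have hdist : sInf {r : ℝ | ∃ v ∈ V, r = traceNorm b (x - v)} = traceNorm b (y : H →L[ℂ] H) := by
    refine IsLeast.csInf_eq ⟨⟨v₀, v₀.2, rfl⟩, ?_⟩
    rintro _ ⟨w, hw, rfl⟩
    exact hv₀ ⟨w, hw⟩
  refine ⟨k, lam, u, ?_, by simpa using hk, fun i => ⟨(hlam i).le, ?_⟩, hsum, hu, ?_,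
    fun w hw => hann ⟨w, hw⟩⟩
  · rcases Nat.eq_zero_or_pos k with rfl | h
    · simp at hsum
    · exact h
  · rw [← hsum]
    exact Finset.single_le_sum (fun j _ => (hlam j).le) (Finset.mem_univ i)
  · rw [hdist]
    have hX : ∀ i, traceAlong b (u i * x) =
        traceNorm b (y : H →L[ℂ] H) + tracePairing b (u i) (Submodule.inclusion hVT v₀) := by
      intro i
      rw [← huy i, ← map_add, sub_add_cancel]
      rfl
    simp only [hX, mul_add, Finset.sum_add_distrib, hann v₀, ← Finset.sum_mul, add_zero]
    rw [← Complex.ofReal_sum, hsum, Complex.ofReal_one, one_mul]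
end

section
/- Let H be an infinite-dimensional separable complex Hilbert space. The set of extreme points of the closed unit ball of the dual space (L¹(B(H)))* is exactly { ρ_u : u ∈ B(H), u*u = Id_H or uu* = Id_H }, where ρ_u(a) = Tr(au) for a ∈ L¹(B(H)); that is, a norm-one functional on the trace class is an extreme point of the dual unit ball if and only if it is induced by an isometry or a co-isometry of H. -/
open scoped InnerProductSpace

open ContinuousLinearMap in
/-- `A = 1 - u* u` satisfies `A² ≤ A` for a contraction `u`, in quadratic form. -/
lemma norm_sub_adjoint_apply_sq_le {H : Type*} [NormedAddCommGroup H]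
    [InnerProductSpace ℂ H] [CompleteSpace H] {u : H →L[ℂ] H} (hu : ‖u‖ ≤ 1) (x : H) :
    ‖x - adjoint u (u x)‖ ^ 2 ≤ ‖x‖ ^ 2 - ‖u x‖ ^ 2 := by
  have h1 : ‖adjoint u (u x)‖ ≤ ‖u x‖ := by
    have := (adjoint u).le_of_opNorm_le (c := 1) (by simpa using hu) (u x)
    simpa using this
  have h2 : (⟪x, adjoint u (u x)⟫_ℂ).re = ‖u x‖ ^ 2 := by
    rw [adjoint_inner_right]
    exact inner_self_eq_norm_sq (𝕜 := ℂ) (u x)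
  have h3 := norm_sub_sq (𝕜 := ℂ) x (adjoint u (u x))
  simp only [RCLike.re_eq_complex_re] at h3
  nlinarith [norm_nonneg (adjoint u (u x)), norm_nonneg (u x)]

open ContinuousLinearMap in
/-- A contraction stays a contraction after a small rank one perturbation between the defect
spaces of `u` and `u*`. -/
lemma norm_add_rankOne_defect_le_one {H : Type*} [NormedAddCommGroup H]
    [InnerProductSpace ℂ H] [CompleteSpace H] {u : H →L[ℂ] H} (hu : ‖u‖ ≤ 1) {ξ η : H}
    (h : ‖ξ‖ * ‖η‖ ≤ 1 / 3) :
    ‖u + InnerProductSpace.rankOne ℂ (η - u (adjoint u η)) (ξ - adjoint u (u ξ))‖ ≤ 1 := by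
  refine opNorm_le_bound _ zero_le_one fun x => ?_
  rw [one_mul, add_apply, InnerProductSpace.rankOne_apply]
  set y := x - adjoint u (u x) with hy
  have hsq : ‖y‖ ^ 2 ≤ ‖x‖ ^ 2 - ‖u x‖ ^ 2 := norm_sub_adjoint_apply_sq_le hu x
  have huy : ‖u y‖ ≤ ‖y‖ := by simpa using u.le_of_opNorm_le hu y
  have hξ : ⟪ξ - adjoint u (u ξ), x⟫_ℂ = ⟪ξ, y⟫_ℂ := by
    simp only [hy, inner_sub_left, inner_sub_right, adjoint_inner_left, adjoint_inner_right]
  have hη : ⟪u x, η - u (adjoint u η)⟫_ℂ = ⟪u y, η⟫_ℂ := by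
    rw [hy, map_sub, inner_sub_left, inner_sub_right, ← adjoint_inner_left,
      ← adjoint_inner_right u (adjoint u (u x))]
  have hη' : ‖η - u (adjoint u η)‖ ≤ ‖η‖ := by
    have hu' : ‖adjoint u‖ ≤ 1 := by simpa using hu
    have := norm_sub_adjoint_apply_sq_le hu' η
    rw [adjoint_adjoint] at this
    refine (sq_le_sq₀ (norm_nonneg _) (norm_nonneg _)).1 ?_
    nlinarith [norm_nonneg (adjoint u η)]
  rw [hξ]
  set c := ⟪ξ, y⟫_ℂ
  have hc : ‖c‖ ≤ ‖ξ‖ * ‖y‖ := norm_inner_le_norm _ _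
  have hcross : (⟪u x, c • (η - u (adjoint u η))⟫_ℂ).re ≤ 1 / 3 * ‖y‖ ^ 2 := by
    rw [inner_smul_right, hη]
    calc (c * ⟪u y, η⟫_ℂ).re ≤ ‖c * ⟪u y, η⟫_ℂ‖ := Complex.re_le_norm _
      _ = ‖c‖ * ‖⟪u y, η⟫_ℂ‖ := norm_mul _ _
      _ ≤ (‖ξ‖ * ‖y‖) * (‖y‖ * ‖η‖) := by
        gcongr
        exact (norm_inner_le_norm _ _).trans (by gcongr)
      _ = (‖ξ‖ * ‖η‖) * ‖y‖ ^ 2 := by ring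
      _ ≤ 1 / 3 * ‖y‖ ^ 2 := by gcongr
  have hnorm : ‖c • (η - u (adjoint u η))‖ ≤ 1 / 3 * ‖y‖ := by
    rw [norm_smul]
    calc ‖c‖ * ‖η - u (adjoint u η)‖ ≤ (‖ξ‖ * ‖y‖) * ‖η‖ := by gcongr
      _ = (‖ξ‖ * ‖η‖) * ‖y‖ := by ring
      _ ≤ 1 / 3 * ‖y‖ := by gcongr
  refine (sq_le_sq₀ (norm_nonneg _) (norm_nonneg _)).1 ?_
  have hadd := norm_add_sq (𝕜 := ℂ) (u x) (c • (η - u (adjoint u η)))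
  simp only [RCLike.re_eq_complex_re] at hadd
  nlinarith [norm_nonneg (c • (η - u (adjoint u η))), norm_nonneg y]

open ContinuousLinearMap in
/-- Isometries are extreme in the unit ball, by strict convexity of the Hilbert space. -/
lemma mem_extremePoints_of_adjoint_mul_self {H : Type*} [NormedAddCommGroup H]
    [InnerProductSpace ℂ H] [CompleteSpace H] {u : H →L[ℂ] H} (hu : adjoint u * u = 1) :
    u ∈ Set.extremePoints ℝ (Metric.closedBall (0 : H →L[ℂ] H) 1) := by
  have hiso : ∀ v, ‖u v‖ = ‖v‖ := (norm_map_iff_adjoint_comp_self u).2 hu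
  refine mem_extremePoints_iff_left.2 ⟨?_, ?_⟩
  · rw [mem_closedBall_zero_iff]
    exact opNorm_le_bound _ zero_le_one fun x => by simp [hiso]
  · rintro x hx y hy ⟨s, t, hs, ht, hst, rfl⟩
    rw [mem_closedBall_zero_iff] at hx hy
    ext v
    have hxv : ‖x v‖ ≤ ‖v‖ := by simpa using x.le_of_opNorm_le hx v
    have hyv : ‖y v‖ ≤ ‖v‖ := by simpa using y.le_of_opNorm_le hy v
    have hxy : x v = y v := by
      by_contra hne
      let _ : InnerProductSpace ℝ H := InnerProductSpace.complexToReal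
      have := norm_combo_lt_of_ne hxv hyv hne hs ht hst
      exact this.ne (by simpa using hiso v)
    simp [← hxy, ← add_smul, hst]

open ContinuousLinearMap in
/-- The extreme points of the unit ball of `B(H)` are stable under taking adjoints. -/
lemma adjoint_mem_extremePoints_closedBall {H : Type*} [NormedAddCommGroup H]
    [InnerProductSpace ℂ H] [CompleteSpace H] {u : H →L[ℂ] H}
    (hu : u ∈ Set.extremePoints ℝ (Metric.closedBall (0 : H →L[ℂ] H) 1)) :
    adjoint u ∈ Set.extremePoints ℝ (Metric.closedBall (0 : H →L[ℂ] H) 1) := by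
  rw [mem_extremePoints_iff_left] at hu ⊢
  refine ⟨by simpa using hu.1, ?_⟩
  rintro x hx y hy ⟨s, t, hs, ht, hst, hxy⟩
  rw [← hu.2 (adjoint x) (by simpa using hx) (adjoint y) (by simpa using hy)
    ⟨s, t, hs, ht, hst, ?_⟩, adjoint_adjoint]
  rw [← adjoint_adjoint u, ← hxy]
  ext v
  refine ext_inner_left ℂ fun w => ?_
  simp [adjoint_inner_right, inner_add_right, inner_smul_left_eq_smul,
    inner_smul_right_eq_smul]

open ContinuousLinearMap in
/-- An extreme point of the unit ball of `B(H)` is an isometry or a co-isometry. -/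
lemma isometry_or_coisometry_of_mem_extremePoints_s12 {H : Type*} [NormedAddCommGroup H]
    [InnerProductSpace ℂ H] [CompleteSpace H] {u : H →L[ℂ] H}
    (hu : u ∈ Set.extremePoints ℝ (Metric.closedBall (0 : H →L[ℂ] H) 1)) :
    adjoint u * u = 1 ∨ u * adjoint u = 1 := by
  by_contra! hne
  obtain ⟨ξ, hξ⟩ : ∃ ξ, ξ - adjoint u (u ξ) ≠ 0 := by
    by_contra! H0
    exact hne.1 (ContinuousLinearMap.ext fun v => (sub_eq_zero.1 (H0 v)).symm)
  obtain ⟨η, hη⟩ : ∃ η, η - u (adjoint u η) ≠ 0 := by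
    by_contra! H0
    exact hne.2 (ContinuousLinearMap.ext fun v => (sub_eq_zero.1 (H0 v)).symm)
  have hξ0 : ξ ≠ 0 := by rintro rfl; simp at hξ
  have hη0 : η ≠ 0 := by rintro rfl; simp at hη
  have hpos : 0 < ‖ξ‖ * ‖η‖ := mul_pos (norm_pos_iff.2 hξ0) (norm_pos_iff.2 hη0)
  set ε : ℝ := 1 / (3 * (‖ξ‖ * ‖η‖)) with hε
  have hε0 : 0 < ε := by positivity
  set η' : H := (ε : ℂ) • η with hη'
  have hsmall : ‖ξ‖ * ‖η'‖ ≤ 1 / 3 := by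
    rw [hη', norm_smul, Complex.norm_real, Real.norm_of_nonneg hε0.le, hε]
    field_simp
    exact le_rfl
  have hdef : η' - u (adjoint u η') = (ε : ℂ) • (η - u (adjoint u η)) := by
    simp [hη', smul_sub]
  obtain ⟨hball, hext⟩ := mem_extremePoints_iff_left.1 hu
  rw [mem_closedBall_zero_iff] at hball
  set z := InnerProductSpace.rankOne ℂ (η' - u (adjoint u η')) (ξ - adjoint u (u ξ)) with hz
  have hplus : ‖u + z‖ ≤ 1 := norm_add_rankOne_defect_le_one hball hsmall
  have hminus : ‖u - z‖ ≤ 1 := by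
    have := norm_add_rankOne_defect_le_one hball (ξ := ξ) (η := -η') (by simpa using hsmall)
    have hneg : -η' - u (adjoint u (-η')) = -(η' - u (adjoint u η')) := by
      simp only [map_neg]; abel
    rwa [hneg, map_neg, neg_apply, ← sub_eq_add_neg] at this
  have hzu : u + z = u := by
    refine hext _ (mem_closedBall_zero_iff.2 hplus) _ (mem_closedBall_zero_iff.2 hminus)
      ⟨1 / 2, 1 / 2, by norm_num, by norm_num, by norm_num, ?_⟩
    module
  have hz0 : z = 0 := by simpa using hzu
  have happ : z (ξ - adjoint u (u ξ)) = 0 := by rw [hz0, zero_apply]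
  rw [hz, InnerProductSpace.rankOne_apply, hdef, smul_eq_zero, inner_self_eq_zero,
    smul_eq_zero, Complex.ofReal_eq_zero] at happ
  exact happ.elim hξ fun h => h.elim hε0.ne' hη

/-- The extreme points of the closed unit ball of
`(L¹(B(H)))*` are exactly the functionals `ρ_u` with `u` an isometry or a
co-isometry.  Since `u ↦ ρ_u` is an isometric linear isomorphism of `B(H)` onto
`(L¹(B(H)))*` (mapping the unit ball onto the dual unit ball and preserving
extreme points), this says precisely that the extreme points of the closed unit
ball of `B(H)` are the isometries and the co-isometries. -/
theorem extremePoints_dual_unitBall_traceClass {H : Type*} [NormedAddCommGroup H]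
    [InnerProductSpace ℂ H] [CompleteSpace H]
    (hinf : ¬FiniteDimensional ℂ H) (b : HilbertBasis ℕ ℂ H) :
    Set.extremePoints ℝ (Metric.closedBall (0 : H →L[ℂ] H) 1) =
      {u : H →L[ℂ] H | ContinuousLinearMap.adjoint u * u = 1 ∨
        u * ContinuousLinearMap.adjoint u = 1} := by
  ext u
  refine ⟨isometry_or_coisometry_of_mem_extremePoints_s12, ?_⟩
  rintro (h | h)
  · exact mem_extremePoints_of_adjoint_mul_self h
  · rw [← ContinuousLinearMap.adjoint_adjoint u]
    refine adjoint_mem_extremePoints_closedBall (mem_extremePoints_of_adjoint_mul_self ?_)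
    rwa [ContinuousLinearMap.adjoint_adjoint]
end
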